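/- Let n ≥ 3 and let K ⊆ ℝⁿ \ {0} be an open cone, i.e. an open set such that tx ∈ K whenever x ∈ K and t > 0. Let p be a real number with (n−2)/2 < p < n−2 and p ≠ n/2, and set q = n−p−2. Define, for a smooth function u : ℝⁿ → ℝ, the matrix-valued function L*u(x) = Hess u(x) − (Δu(x))·Iₙ, where Δu is the Euclidean Laplacian and Iₙ the n×n identity matrix. Then there exists a constant C > 0, depending only on n and p, such that for every smooth u : ℝⁿ → ℝ whose support is compact and contained in ℝⁿ \ {0}, one has ∫_K ( u(x)² |x|^{−n+2q} + |∇u(x)|² |x|^{2−n+2q} + |Hess u(x)|² |x|^{4−n+2q} ) dx ≤ C ∫_K |L*u(x)|² |x|^{4−n+2q} dx. -/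

import Mathlib

open MeasureTheory

open Pointwise in
/-- On a measurable cone, differentiating the scaling identity `∫ f (t x) = t⁻ⁿ ∫ f` at `t = 1`
gives the integrated Euler identity. -/
theorem setIntegral_fderiv_apply_self_of_cone
    {E : Type*} [NormedAddCommGroup E] [NormedSpace ℝ E] [FiniteDimensional ℝ E]
    [MeasurableSpace E] [BorelSpace E] (μ : Measure E) [μ.IsAddHaarMeasure]
    {K : Set E} (hK : ∀ x ∈ K, ∀ t : ℝ, 0 < t → t • x ∈ K)
    {f : E → ℝ} (hf : ContDiff ℝ 1 f) (hc : HasCompactSupport f) :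
    ∫ x in K, fderiv ℝ f x x ∂μ = -(Module.finrank ℝ E : ℝ) * ∫ x in K, f x ∂μ := by
  have hf' : Continuous (fderiv ℝ f) := hf.continuous_fderiv one_ne_zero
  have hc' : HasCompactSupport (fderiv ℝ f) := hc.fderiv ℝ
  obtain ⟨M, hM⟩ := hf'.bounded_above_of_compact_support hc'
  obtain ⟨R, hR⟩ := hc'.isCompact.isBounded.subset_closedBall (0 : E)
  have hderiv := (hasDerivAt_integral_of_dominated_loc_of_deriv_le
    (μ := μ.restrict K) (F := fun t x => f (t • x)) (F' := fun t x => fderiv ℝ f (t • x) x)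
    (x₀ := (1 : ℝ)) (s := Set.Ioi (1 / 2))
    (bound := (Metric.closedBall (0 : E) (2 * R)).indicator fun x => M * ‖x‖)
    (Ioi_mem_nhds (by norm_num))
    (Filter.Eventually.of_forall fun t =>
      (hf.continuous.comp (continuous_const_smul t)).aestronglyMeasurable)
    (by simpa using (hf.continuous.integrable_of_hasCompactSupport hc).restrict)
    (by
      have : Continuous fun x : E => fderiv ℝ f ((1 : ℝ) • x) x := by fun_prop
      exact this.aestronglyMeasurable)
    (Filter.Eventually.of_forall fun x t ht => by
      have ht0 : (1 / 2 : ℝ) < t := ht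
      by_cases hx : x ∈ Metric.closedBall (0 : E) (2 * R)
      · rw [Set.indicator_of_mem hx]
        exact (ContinuousLinearMap.le_opNorm _ _).trans (by gcongr; exact hM _)
      · rw [Set.indicator_of_notMem hx]
        have : t • x ∉ tsupport (fderiv ℝ f) := fun h => hx <| by
          have h1 := hR h
          rw [mem_closedBall_zero_iff, norm_smul, Real.norm_of_nonneg (by linarith)] at h1
          rw [mem_closedBall_zero_iff]
          nlinarith [norm_nonneg x]
        simp [image_eq_zero_of_notMem_tsupport this])
    (((continuous_const.mul continuous_norm).continuousOn.integrableOn_compact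
      (isCompact_closedBall _ _)).integrable_indicator measurableSet_closedBall).restrict
    (Filter.Eventually.of_forall fun x t _ => by
      have h1 : HasDerivAt (fun t : ℝ => t • x) x t := by
        simpa using (hasDerivAt_id t).smul_const x
      exact ((hf.differentiable one_ne_zero) (t • x)).hasFDerivAt.comp_hasDerivAt t h1)).2
  have hscale : (fun t : ℝ => ∫ x in K, f (t • x) ∂μ) =ᶠ[nhds 1]
      fun t => (t ^ Module.finrank ℝ E)⁻¹ * ∫ x in K, f x ∂μ := by
    filter_upwards [Ioi_mem_nhds (zero_lt_one' ℝ)] with t ht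
    have ht : 0 < t := ht
    have hKt : t • K = K := by
      ext x
      rw [Set.mem_smul_set_iff_inv_smul_mem₀ ht.ne']
      refine ⟨fun h => ?_, fun h => hK x h _ (inv_pos.2 ht)⟩
      simpa [smul_smul, ht.ne'] using hK _ h t ht
    rw [Measure.setIntegral_comp_smul_of_pos μ f K ht, hKt, smul_eq_mul]
  have hpow : HasDerivAt (fun t : ℝ => (t ^ Module.finrank ℝ E)⁻¹ * ∫ x in K, f x ∂μ)
      (-(Module.finrank ℝ E : ℝ) * ∫ x in K, f x ∂μ) 1 := by
    simpa using (((hasDerivAt_pow (Module.finrank ℝ E) (1 : ℝ)).fun_inv (by simp)).mul_const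
      (∫ x in K, f x ∂μ))
  simpa using hderiv.unique (hpow.congr_of_eventuallyEq hscale)

section Weighted

variable {E : Type*} [NormedAddCommGroup E] [InnerProductSpace ℝ E]

/-- A `C^k` function vanishing near the origin stays `C^k` after multiplication by a power of
the norm. -/
theorem ContDiff.mul_norm_rpow {k : WithTop ℕ∞} {g : E → ℝ} (hg : ContDiff ℝ k g)
    (h0 : (0 : E) ∉ tsupport g) (s : ℝ) : ContDiff ℝ k fun x => g x * ‖x‖ ^ s := by
  rw [contDiff_iff_contDiffAt]
  intro x
  by_cases hx : x = 0
  · subst hx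
    refine (contDiffAt_const (c := (0 : ℝ))).congr_of_eventuallyEq ?_
    filter_upwards [(isClosed_tsupport g).isOpen_compl.mem_nhds h0] with y hy
    simp [image_eq_zero_of_notMem_tsupport hy]
  · exact hg.contDiffAt.mul ((contDiffAt_norm ℝ hx).rpow_const_of_ne (norm_ne_zero_iff.2 hx))

theorem fderiv_mul_norm_rpow_apply_self {g : E → ℝ} {x : E} (hg : DifferentiableAt ℝ g x)
    (hx : x ≠ 0) (s : ℝ) : fderiv ℝ (fun y => g y * ‖y‖ ^ s) x x =
      (fderiv ℝ g x x + s * g x) * ‖x‖ ^ s := by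
  have hn : DifferentiableAt ℝ (fun y : E => ‖y‖) x := (contDiffAt_norm ℝ hx).differentiableAt
    one_ne_zero
  have hx' : 0 < ‖x‖ := norm_pos_iff.2 hx
  have h := hg.hasFDerivAt.fun_mul (hn.hasFDerivAt.rpow_const (p := s) (Or.inl hx'.ne'))
  have hs : ‖x‖ ^ (s - 1) * ‖x‖ = ‖x‖ ^ s := by
    rw [← Real.rpow_add_one hx'.ne', sub_add_cancel]
  rw [h.fderiv]
  simp only [add_apply, smul_apply, smul_eq_mul, hn.fderiv_norm_self]
  rw [← hs]
  ring

variable [MeasurableSpace E] [BorelSpace E]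

theorem Continuous.integrable_mul_norm_rpow (μ : Measure E) [IsFiniteMeasureOnCompacts μ]
    {g : E → ℝ} (hg : Continuous g) (hc : HasCompactSupport g) (h0 : (0 : E) ∉ tsupport g)
    (s : ℝ) : Integrable (fun x => g x * ‖x‖ ^ s) μ :=
  ((contDiff_zero (𝕜 := ℝ)).2 hg |>.mul_norm_rpow h0 s).continuous.integrable_of_hasCompactSupport
    hc.mul_right

variable [FiniteDimensional ℝ E]

/-- Radial Hardy inequality on a cone. -/
theorem setIntegral_sq_mul_norm_rpow_le_of_cone (μ : Measure E) [μ.IsAddHaarMeasure]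
    {K : Set E} (hKm : MeasurableSet K) (hK0 : K ⊆ {x | x ≠ 0})
    (hK : ∀ x ∈ K, ∀ t : ℝ, 0 < t → t • x ∈ K)
    {v : E → ℝ} (hv : ContDiff ℝ 1 v) (hc : HasCompactSupport v) (h0 : (0 : E) ∉ tsupport v)
    {s : ℝ} (hs : 0 < Module.finrank ℝ E + s) :
    ∫ x in K, v x ^ 2 * ‖x‖ ^ s ∂μ ≤
      4 / (Module.finrank ℝ E + s) ^ 2 * ∫ x in K, (fderiv ℝ v x x) ^ 2 * ‖x‖ ^ s ∂μ := by
  set a : ℝ := Module.finrank ℝ E + s with ha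
  have hv2 : ContDiff ℝ 1 fun x => v x ^ 2 := hv.pow 2
  have hsub : tsupport (fun x => v x ^ 2) ⊆ tsupport v :=
    closure_mono fun x hx h => hx (by simp [h])
  have h02 : (0 : E) ∉ tsupport fun x => v x ^ 2 := fun h => h0 (hsub h)
  have hc2 : HasCompactSupport fun x => v x ^ 2 := hc.of_isClosed_subset (isClosed_tsupport _) hsub
  have hF : ContDiff ℝ 1 fun x => v x ^ 2 * ‖x‖ ^ s := hv2.mul_norm_rpow h02 s
  have hFc : HasCompactSupport fun x => v x ^ 2 * ‖x‖ ^ s := hc2.mul_right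
  have hF' : Continuous fun x => fderiv ℝ (fun y => v y ^ 2 * ‖y‖ ^ s) x x :=
    (hF.continuous_fderiv one_ne_zero).clm_apply continuous_id
  have hF'c : HasCompactSupport fun x => fderiv ℝ (fun y => v y ^ 2 * ‖y‖ ^ s) x x :=
    (hFc.fderiv ℝ).mono fun x hx (h : fderiv ℝ _ x = 0) => hx (by simp [h])
  have hD : Continuous fun x => (fderiv ℝ v x x) ^ 2 :=
    ((hv.continuous_fderiv one_ne_zero).clm_apply continuous_id).pow 2
  have hDsub : tsupport (fun x => (fderiv ℝ v x x) ^ 2) ⊆ tsupport v :=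
    (closure_mono fun x (hx : _ ≠ _) (h : fderiv ℝ v x = 0) => hx (by simp [h])).trans
      (tsupport_fderiv_subset ℝ)
  have iF := (hF.continuous.integrable_of_hasCompactSupport (μ := μ) hFc).restrict (s := K)
  have iF' := (hF'.integrable_of_hasCompactSupport (μ := μ) hF'c).restrict (s := K)
  have iD := (hD.integrable_mul_norm_rpow μ
    (hc.of_isClosed_subset (isClosed_tsupport _) hDsub) (fun h => h0 (hDsub h)) s).restrict (s := K)
  have euler := setIntegral_fderiv_apply_self_of_cone μ hK hF hFc
  have key : ∫ x in K, (a / 2 - Module.finrank ℝ E) * (v x ^ 2 * ‖x‖ ^ s) ∂μ ≤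
      ∫ x in K, (2 / a * ((fderiv ℝ v x x) ^ 2 * ‖x‖ ^ s) +
        fderiv ℝ (fun y => v y ^ 2 * ‖y‖ ^ s) x x) ∂μ := by
    refine setIntegral_mono_on (iF.const_mul _) ((iD.const_mul _).add iF') hKm fun x hx => ?_
    have hvx : DifferentiableAt ℝ v x := hv.differentiable one_ne_zero x
    rw [fderiv_mul_norm_rpow_apply_self (hvx.fun_pow 2) (hK0 hx), fderiv_fun_pow 2 hvx]
    have hw : 0 ≤ ‖x‖ ^ s := by positivity
    have hsq : 0 ≤ 2 / a * (fderiv ℝ v x x + a / 2 * v x) ^ 2 * ‖x‖ ^ s := by positivity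
    have hexp : 2 / a * (fderiv ℝ v x x + a / 2 * v x) ^ 2 =
        2 / a * (fderiv ℝ v x x) ^ 2 + 2 * v x * fderiv ℝ v x x + a / 2 * v x ^ 2 := by
      field_simp
      ring
    rw [hexp] at hsq
    simp only [smul_apply, smul_eq_mul, nsmul_eq_mul]
    have hs' : s = a - Module.finrank ℝ E := by rw [ha]; ring
    generalize ‖x‖ ^ s = w at *
    rw [hs']
    norm_num
    nlinarith
  rw [integral_add (iD.const_mul _) iF', integral_const_mul, integral_const_mul, euler] at key
  have key' : a / 2 * ∫ x in K, v x ^ 2 * ‖x‖ ^ s ∂μ ≤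
      2 / a * ∫ x in K, (fderiv ℝ v x x) ^ 2 * ‖x‖ ^ s ∂μ := by linarith
  calc _ = 2 / a * (a / 2 * ∫ x in K, v x ^ 2 * ‖x‖ ^ s ∂μ) := by field_simp
    _ ≤ 2 / a * (2 / a * ∫ x in K, (fderiv ℝ v x x) ^ 2 * ‖x‖ ^ s ∂μ) := by gcongr
    _ = _ := by rw [← mul_assoc, div_mul_div_comm, ← sq a]; norm_num

end Weighted

section Euclidean

variable {n : ℕ}

theorem sq_apply_self_le_sum_sq_mul_norm_sq (L : EuclideanSpace ℝ (Fin n) →L[ℝ] ℝ)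
    (x : EuclideanSpace ℝ (Fin n)) :
    (L x) ^ 2 ≤ (∑ i, (L (EuclideanSpace.single i 1)) ^ 2) * ‖x‖ ^ 2 := by
  have hx : L x = ∑ i, L (EuclideanSpace.single i 1) * x i := by
    conv_lhs => rw [← (EuclideanSpace.basisFun (Fin n) ℝ).sum_repr x]
    simp [map_sum, mul_comm]
  rw [hx, EuclideanSpace.real_norm_sq_eq]
  exact Finset.sum_mul_sq_le_sq_mul_sq _ _ _

theorem tsupport_sum_sq_subset {X ι : Type*} [TopologicalSpace X] [Fintype ι] {g : ι → X → ℝ}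
    {S : Set X} (hS : IsClosed S) (hg : ∀ i, tsupport (g i) ⊆ S) :
    tsupport (fun x => ∑ i, (g i x) ^ 2) ⊆ S := by
  refine closure_minimal (fun x hx => ?_) hS
  by_contra h
  exact hx (Finset.sum_eq_zero fun i _ => by
    simp [image_eq_zero_of_notMem_tsupport fun h' => h (hg i h')])

/-- The Hardy inequality on a cone in `ℝⁿ`, with the full gradient on the right. -/
theorem setIntegral_sq_mul_norm_rpow_le_gradient_of_cone
    {K : Set (EuclideanSpace ℝ (Fin n))} (hKm : MeasurableSet K) (hK0 : K ⊆ {x | x ≠ 0})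
    (hK : ∀ x ∈ K, ∀ t : ℝ, 0 < t → t • x ∈ K)
    {v : EuclideanSpace ℝ (Fin n) → ℝ} (hv : ContDiff ℝ 1 v) (hc : HasCompactSupport v)
    (h0 : 0 ∉ tsupport v) {s : ℝ} (hs : 0 < n + s) :
    ∫ x in K, v x ^ 2 * ‖x‖ ^ s ≤ 4 / (n + s) ^ 2 *
      ∫ x in K, (∑ i, (fderiv ℝ v x (EuclideanSpace.single i 1)) ^ 2) * ‖x‖ ^ (2 + s) := by
  have hardy := setIntegral_sq_mul_norm_rpow_le_of_cone volume hKm hK0 hK hv hc h0 (s := s)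
    (by simpa using hs)
  rw [finrank_euclideanSpace_fin] at hardy
  refine hardy.trans ?_
  have hsub : tsupport (fun x => ∑ i, (fderiv ℝ v x (EuclideanSpace.single i 1)) ^ 2) ⊆
      tsupport v :=
    tsupport_sum_sq_subset (isClosed_tsupport v) fun i => tsupport_fderiv_apply_subset ℝ _
  have hcont : Continuous fun x => ∑ i, (fderiv ℝ v x (EuclideanSpace.single i 1)) ^ 2 :=
    continuous_finsetSum _ fun i _ =>
      ((hv.continuous_fderiv one_ne_zero).clm_apply continuous_const).pow 2
  refine mul_le_mul_of_nonneg_left ?_ (by positivity)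
  refine integral_mono_of_nonneg (Filter.Eventually.of_forall fun x => by positivity)
    (hcont.integrable_mul_norm_rpow volume (hc.of_isClosed_subset (isClosed_tsupport _) hsub)
      (fun h => h0 (hsub h)) _).restrict ?_
  filter_upwards [ae_restrict_mem hKm] with x hx
  have hx0 : 0 < ‖x‖ := norm_pos_iff.2 (hK0 hx)
  rw [Real.rpow_add hx0, Real.rpow_two, ← mul_assoc]
  gcongr
  exact sq_apply_self_le_sum_sq_mul_norm_sq _ _

/-- `|H|² ≤ |H - (tr H) I|²` in dimension at least two. -/
theorem sum_sq_le_sum_sq_sub_trace (hn : 2 ≤ n) (H : Fin n → Fin n → ℝ) :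
    ∑ i, ∑ j, H i j ^ 2 ≤
      ∑ i, ∑ j, (H i j - (∑ k, H k k) * (if i = j then (1 : ℝ) else 0)) ^ 2 := by
  set τ := ∑ k, H k k with hτ
  have hterm : ∀ i j, (H i j - τ * (if i = j then (1 : ℝ) else 0)) ^ 2 =
      H i j ^ 2 + (if i = j then τ ^ 2 - 2 * τ * H i j else 0) := by
    intro i j
    split_ifs <;> ring
  have hn' : (2 : ℝ) ≤ n := by exact_mod_cast hn
  simp only [hterm, Finset.sum_add_distrib, Finset.sum_ite_eq, Finset.mem_univ, if_true,
    Finset.sum_sub_distrib, ← Finset.mul_sum, ← hτ, Finset.sum_const, Finset.card_univ,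
    Fintype.card_fin, nsmul_eq_mul]
  nlinarith [sq_nonneg τ]

end Euclidean

/-- Basic Estimate I: coercivity of the adjoint linearized scalar curvature operator
`L*u = Hess u - (Δu)·Iₙ` at the Euclidean metric, on open cones in ℝⁿ.
For `(n-2)/2 < p < n-2`, `p ≠ n/2`, and `q = n - p - 2`, there is `C = C(n,p) > 0`
such that the full weighted H²-norm of `u` is controlled by the weighted L²-norm of
`L*u`, for all smooth `u` with compact support in `ℝⁿ \ {0}`. -/
theorem basic_estimate_I
    (n : ℕ) (hn : 3 ≤ n)
    (p : ℝ) (hp0 : ((n : ℝ) - 2) / 2 < p) (hp1 : p < (n : ℝ) - 2)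
    (hp2 : p ≠ (n : ℝ) / 2)
    (q : ℝ) (hq : q = (n : ℝ) - p - 2) :
    ∃ C : ℝ, 0 < C ∧
      ∀ K : Set (EuclideanSpace ℝ (Fin n)),
        IsOpen K → K ⊆ {x | x ≠ 0} →
        (∀ x ∈ K, ∀ t : ℝ, 0 < t → t • x ∈ K) →
        ∀ u : EuclideanSpace ℝ (Fin n) → ℝ,
          ContDiff ℝ (⊤ : ℕ∞) u → HasCompactSupport u → tsupport u ⊆ {x | x ≠ 0} →
          ∫ x in K,
              (u x ^ 2 * ‖x‖ ^ (-(n : ℝ) + 2 * q) +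
                (∑ i : Fin n, (fderiv ℝ u x (EuclideanSpace.single i 1)) ^ 2) *
                  ‖x‖ ^ (2 - (n : ℝ) + 2 * q) +
                (∑ i : Fin n, ∑ j : Fin n,
                    (fderiv ℝ (fun y => fderiv ℝ u y (EuclideanSpace.single i 1)) x
                        (EuclideanSpace.single j 1)) ^ 2) *
                  ‖x‖ ^ (4 - (n : ℝ) + 2 * q)) ≤
            C * ∫ x in K,
              (∑ i : Fin n, ∑ j : Fin n,
                  ((fderiv ℝ (fun y => fderiv ℝ u y (EuclideanSpace.single i 1)) x
                      (EuclideanSpace.single j 1)) -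
                    (∑ k : Fin n,
                      fderiv ℝ (fun y => fderiv ℝ u y (EuclideanSpace.single k 1)) x
                        (EuclideanSpace.single k 1)) *
                      (if i = j then (1 : ℝ) else 0)) ^ 2) *
                ‖x‖ ^ (4 - (n : ℝ) + 2 * q) := by
  obtain rfl : q = (n : ℝ) - p - 2 := hq
  set q : ℝ := (n : ℝ) - p - 2
  have hq : 0 < q := by simp only [q]; linarith
  refine ⟨1 / q ^ 2 * (1 / (q + 1) ^ 2) + 1 / (q + 1) ^ 2 + 1, by positivity, ?_⟩
  intro K hKo hK0 hK u hu hc hsupp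
  have h0 : (0 : EuclideanSpace ℝ (Fin n)) ∉ tsupport u := fun h => hsupp h rfl
  have hKm := hKo.measurableSet
  set e : Fin n → EuclideanSpace ℝ (Fin n) := fun i => EuclideanSpace.single i 1
  have hu1 : ∀ i, ContDiff ℝ (⊤ : ℕ∞) fun x => fderiv ℝ u x (e i) := fun i =>
    (hu.fderiv_right (by simp)).clm_apply contDiff_const
  have hs1 : ∀ i, tsupport (fun x => fderiv ℝ u x (e i)) ⊆ tsupport u := fun i =>
    tsupport_fderiv_apply_subset ℝ _
  have hu2 : ∀ i j, Continuous fun x => fderiv ℝ (fun y => fderiv ℝ u y (e i)) x (e j) :=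
    fun i j => ((hu1 i).continuous_fderiv (by simp)).clm_apply continuous_const
  have hs2 : ∀ i j, tsupport (fun x => fderiv ℝ (fun y => fderiv ℝ u y (e i)) x (e j)) ⊆
      tsupport u := fun i j => (tsupport_fderiv_apply_subset ℝ _).trans (hs1 i)
  have hint : ∀ {g : EuclideanSpace ℝ (Fin n) → ℝ} (s : ℝ), Continuous g →
      (∀ x ∉ tsupport u, g x = 0) → Integrable (fun x => g x * ‖x‖ ^ s) (volume.restrict K) := by
    intro g s hg hz
    have hsub : tsupport g ⊆ tsupport u :=
      closure_minimal (fun x hx => by_contra fun h => hx (hz x h)) (isClosed_tsupport u)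
    exact (hg.integrable_mul_norm_rpow volume (hc.of_isClosed_subset (isClosed_tsupport _) hsub)
      (fun h => h0 (hsub h)) s).restrict
  have z1 : ∀ x ∉ tsupport u, ∀ i, fderiv ℝ u x (e i) = 0 := fun x hx i =>
    image_eq_zero_of_notMem_tsupport (f := fun x => fderiv ℝ u x (e i)) fun h => hx (hs1 i h)
  have z2 : ∀ x ∉ tsupport u, ∀ i j,
      fderiv ℝ (fun y => fderiv ℝ u y (e i)) x (e j) = 0 := fun x hx i j =>
    image_eq_zero_of_notMem_tsupport
      (f := fun x => fderiv ℝ (fun y => fderiv ℝ u y (e i)) x (e j)) fun h => hx (hs2 i j h)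
  have c1 : ∀ i, Continuous fun x => fderiv ℝ u x (e i) := fun i => (hu1 i).continuous
  have iA := hint (g := fun x => u x ^ 2) (-(n : ℝ) + 2 * q) (hu.continuous.pow 2)
    (fun x hx => by simp [image_eq_zero_of_notMem_tsupport hx])
  have iB' : ∀ i, _ := fun i => hint (g := fun x => (fderiv ℝ u x (e i)) ^ 2)
    (2 - (n : ℝ) + 2 * q) ((c1 i).pow 2) (fun x hx => by simp [z1 x hx])
  have iB := hint (g := fun x => ∑ i, (fderiv ℝ u x (e i)) ^ 2) (2 - (n : ℝ) + 2 * q)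
    (by fun_prop) (fun x hx => by simp [z1 x hx])
  have iH' : ∀ i, _ := fun i => hint
    (g := fun x => ∑ j, (fderiv ℝ (fun y => fderiv ℝ u y (e i)) x (e j)) ^ 2)
    (4 - (n : ℝ) + 2 * q) (by fun_prop) (fun x hx => by simp [z2 x hx])
  have iH := hint (g := fun x => ∑ i, ∑ j, (fderiv ℝ (fun y => fderiv ℝ u y (e i)) x (e j)) ^ 2)
    (4 - (n : ℝ) + 2 * q) (by fun_prop) (fun x hx => by simp [z2 x hx])
  have iR := hint (g := fun x => ∑ i, ∑ j, (fderiv ℝ (fun y => fderiv ℝ u y (e i)) x (e j) -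
      (∑ k, fderiv ℝ (fun y => fderiv ℝ u y (e k)) x (e k)) *
        (if i = j then (1 : ℝ) else 0)) ^ 2)
    (4 - (n : ℝ) + 2 * q) (by fun_prop) (fun x hx => by simp [z2 x hx])
  have hA := setIntegral_sq_mul_norm_rpow_le_gradient_of_cone hKm hK0 hK (hu.of_le (by simp)) hc h0
    (s := -(n : ℝ) + 2 * q) (by linarith)
  have hB' : ∀ i, _ := fun i => setIntegral_sq_mul_norm_rpow_le_gradient_of_cone hKm hK0 hK
    ((hu1 i).of_le (by simp)) (hc.of_isClosed_subset (isClosed_tsupport _) (hs1 i))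
    (fun h => h0 (hs1 i h)) (s := 2 - (n : ℝ) + 2 * q) (by linarith)
  have hB := Finset.sum_le_sum fun i (_ : i ∈ Finset.univ) => hB' i
  have hH := integral_mono iH iR fun x => mul_le_mul_of_nonneg_right
    (sum_sq_le_sum_sq_sub_trace (by lia)
      fun i j => fderiv ℝ (fun y => fderiv ℝ u y (e i)) x (e j))
    (Real.rpow_nonneg (norm_nonneg x) (4 - (n : ℝ) + 2 * q))
  rw [show 2 + (-(n : ℝ) + 2 * q) = 2 - n + 2 * q by ring,
    show (n : ℝ) + (-n + 2 * q) = 2 * q by ring] at hA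
  rw [show 2 + (2 - (n : ℝ) + 2 * q) = 4 - n + 2 * q by ring,
    show (n : ℝ) + (2 - n + 2 * q) = 2 * (q + 1) by ring, ← Finset.mul_sum,
    ← integral_finsetSum _ fun i _ => iB' i, ← integral_finsetSum _ fun i _ => iH' i] at hB
  simp only [← Finset.sum_mul] at hB
  have four : ∀ t : ℝ, 4 / (2 * t) ^ 2 = 1 / t ^ 2 := fun t => by
    rw [mul_pow, show (4 : ℝ) = 2 ^ 2 * 1 by norm_num, mul_div_mul_left _ _ (by norm_num)]
  rw [four] at hA hB
  have hAB := hA.trans (mul_le_mul_of_nonneg_left hB (by positivity))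
  have hc1 := mul_le_mul_of_nonneg_left hH
    (show 0 ≤ 1 / q ^ 2 * (1 / (q + 1) ^ 2) + 1 / (q + 1) ^ 2 + 1 by positivity)
  refine (integral_add (iA.add iB) iH).trans_le
    (((add_le_add (integral_add iA iB).le le_rfl).trans ?_).trans hc1)
  simp only [e] at hAB hB ⊢
  linarith
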